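/- Let K be a commutative semiring, m ≥ 1 and h ≥ 1. Consider the ground set {⊥, ⊤} ∪ {s₁, …, s_m} ∪ {t₁, …, t_h} with the generating relations ⊥ ≺ s₁, ⊥ ≺ t₁, the chains s₁ ≺ s₂ ≺ ⋯ ≺ s_m and t₁ ≺ t₂ ≺ ⋯ ≺ t_h, the cross relations s₁ ≺ t_h and t₁ ≺ s_m, and s_m ≺ ⊤, t_h ≺ ⊤. Assign weight a_i to s_i, weight b_j to t_j, and the same weight c to both ⊥ and ⊤. Then the sum over all down-sets S of ∏_{x ∈ S} w(x) equals 1 + c · [ (Σ_{k=0}^{m} ∏_{i=1}^{k} a_i) · (Σ_{l=0}^{h} ∏_{j=1}^{l} b_j) − ∏_{i=1}^{m} a_i − ∏_{j=1}^{h} b_j ] + c² · (∏_{i=1}^{m} a_i)(∏_{j=1}^{h} b_j). -/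

import Mathlib

/-!
The closed formula, established inside the proof of Proposition 3.4 of the paper, for
the weighted sum over order ideals of the poset `P_{γ^{(p,q)}}` associated to a
doubly-notched arc whose underlying plain arc lies in the triangulation: the ground set
is `{⊥, ⊤} ∪ {s₁, …, s_m} ∪ {t₁, …, t_h}` with generating relations `⊥ ≺ s₁`, `⊥ ≺ t₁`,
the two chains, the cross relations `s₁ ≺ t_h` and `t₁ ≺ s_m`, and `s_m ≺ ⊤`,
`t_h ≺ ⊤`; `⊥` and `⊤` both carry the weight `c`.

The paper's identity reads
`Z = 1 + c·[(Σ_{k=0}^{m} ∏_{i≤k} a_i)·(Σ_{l=0}^{h} ∏_{j≤l} b_j) − ∏ a − ∏ b] + c²·∏a∏b`;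
since `K` is only assumed to be a commutative semiring, the subtraction is moved to the
left-hand side, giving the equivalent identity
`Z + c·∏a + c·∏b = 1 + c·(ΣΣ) + c²·∏a∏b`.
-/

attribute [local instance] Classical.propDecidable

noncomputable section

/-- The ideal sum of a configuration: the sum, over all down-sets `S` of the ground set
(`S ⊆ ground`, closed under the generating relations: `rel x y` with `x ∈ ground` and
`y ∈ S` implies `x ∈ S`), of the product of the weights of the elements of `S`. -/
def idealSum {α K : Type*} [CommSemiring K]
    (ground : Finset α) (rel : α → α → Prop) (w : α → K) : K :=
  ∑ S ∈ ground.powerset.filter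
      (fun S => ∀ x ∈ ground, ∀ y ∈ S, rel x y → x ∈ S),
    ∏ x ∈ S, w x

/-- The generating chain `f lo ≺ f (lo+1) ≺ ⋯ ≺ f hi`. -/
def chainRel {α : Type*} (f : ℕ → α) (lo hi : ℕ) : α → α → Prop :=
  fun p q => ∃ i, lo ≤ i ∧ i + 1 ≤ hi ∧ p = f i ∧ q = f (i + 1)

/-- The single generating relation `u ≺ v`. -/
def covRel {α : Type*} (u v : α) : α → α → Prop := fun p q => p = u ∧ q = v

/-- The elements `f lo, …, f hi`. -/
def natGround {α : Type*} (f : ℕ → α) (lo hi : ℕ) : Finset α := (Finset.Icc lo hi).image f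

/-- The minimum element `⊥ = 0⁻`. -/
def ebot : Bool ⊕ (ℕ ⊕ ℕ) := Sum.inl false

/-- The maximum element `⊤ = 0⁺`. -/
def etop : Bool ⊕ (ℕ ⊕ ℕ) := Sum.inl true

/-- The elements `s₁, …, s_m` (the spokes at `p` other than `γ`). -/
def es : ℕ → Bool ⊕ (ℕ ⊕ ℕ) := fun i => Sum.inr (Sum.inl i)

/-- The elements `t₁, …, t_h` (the spokes at `q` other than `γ`). -/
def et : ℕ → Bool ⊕ (ℕ ⊕ ℕ) := fun j => Sum.inr (Sum.inr j)

theorem mem_filter_explicit {α : Type*} (p : α → Prop) (inst : DecidablePred p)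
    (s : Finset α) (a : α) : a ∈ @Finset.filter α p inst s ↔ a ∈ s ∧ p a :=
  Finset.mem_filter

theorem idealSum_eq_sum {α K : Type*} [CommSemiring K] {ground : Finset α}
    {rel : α → α → Prop} (w : α → K) (Z : Finset (Finset α))
    (hZ : ∀ S, (S ⊆ ground ∧ ∀ x ∈ ground, ∀ y ∈ S, rel x y → x ∈ S) ↔ S ∈ Z) :
    idealSum ground rel w = ∑ S ∈ Z, ∏ x ∈ S, w x := by
  rw [idealSum]
  congr 1
  ext S
  rw [← hZ, ← Finset.mem_powerset]
  exact mem_filter_explicit _ _ _ _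

theorem exists_initial_segment (P : ℕ → Prop) (n : ℕ)
    (hP : ∀ i, 1 ≤ i → i + 1 ≤ n → P (i + 1) → P i) :
    ∃ k ≤ n, ∀ i, 1 ≤ i → i ≤ n → (P i ↔ i ≤ k) := by
  induction n with
  | zero => exact ⟨0, le_rfl, fun i h1 h2 => by omega⟩
  | succ n ih =>
    obtain ⟨k, hk, hPk⟩ := ih fun i h1 h2 => hP i h1 (by omega)
    by_cases hn : P (n + 1)
    · refine ⟨n + 1, le_rfl, fun i h1 h2 => ⟨fun _ => h2, fun _ => ?_⟩⟩
      induction h2 using Nat.decreasingInduction with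
      | self => exact hn
      | of_succ j hj ihj => exact hP j h1 (by omega) (ihj (by omega) (by omega))
    · refine ⟨k, by omega, fun i h1 h2 => ?_⟩
      rcases Nat.lt_or_ge n i with hi | hi
      · obtain rfl : i = n + 1 := by omega
        exact ⟨fun h => absurd h hn, fun h => by omega⟩
      · exact hPk i h1 hi

/-- The elements of `B` among `⊥`, `⊤`, together with `s₁, …, s_k` and `t₁, …, t_l`. -/
def cutSet (B : Finset Bool) (k l : ℕ) : Finset (Bool ⊕ (ℕ ⊕ ℕ)) :=
  B.disjSum ((Finset.Icc 1 k).disjSum (Finset.Icc 1 l))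

theorem inl_mem_cutSet {B : Finset Bool} {k l : ℕ} {x : Bool} :
    Sum.inl x ∈ cutSet B k l ↔ x ∈ B := by
  simp [cutSet]

theorem es_mem_cutSet {B : Finset Bool} {k l i : ℕ} :
    Sum.inr (Sum.inl i) ∈ cutSet B k l ↔ 1 ≤ i ∧ i ≤ k := by
  simp [cutSet]

theorem et_mem_cutSet {B : Finset Bool} {k l j : ℕ} :
    Sum.inr (Sum.inr j) ∈ cutSet B k l ↔ 1 ≤ j ∧ j ≤ l := by
  simp [cutSet]

theorem cutSet_inj {B B' : Finset Bool} {k l k' l' : ℕ} :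
    cutSet B k l = cutSet B' k' l' ↔ B = B' ∧ k = k' ∧ l = l' := by
  refine ⟨fun h => ⟨?_, ?_, ?_⟩, by rintro ⟨rfl, rfl, rfl⟩; rfl⟩
  · ext x
    rw [← inl_mem_cutSet (k := k) (l := l), h, inl_mem_cutSet]
  · have key : ∀ i, 1 ≤ i ∧ i ≤ k ↔ 1 ≤ i ∧ i ≤ k' := fun i => by
      rw [← es_mem_cutSet (B := B) (l := l), h, es_mem_cutSet]
    have h1 := key k
    have h2 := key k'
    omega
  · have key : ∀ j, 1 ≤ j ∧ j ≤ l ↔ 1 ≤ j ∧ j ≤ l' := fun j => by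
      rw [← et_mem_cutSet (B := B) (k := k), h, et_mem_cutSet]
    have h1 := key l
    have h2 := key l'
    omega

theorem prod_cutSet {K : Type*} [CommSemiring K] (a b : ℕ → K) (c : K)
    (B : Finset Bool) (k l : ℕ) :
    ∏ x ∈ cutSet B k l, Sum.elim (fun _ => c) (Sum.elim a b) x =
      c ^ B.card * ((∏ i ∈ Finset.Icc 1 k, a i) * ∏ j ∈ Finset.Icc 1 l, b j) := by
  simp [cutSet, Finset.prod_disjSum]

theorem ground_eq_cutSet (m h : ℕ) :
    ({ebot, etop} ∪ natGround es 1 m ∪ natGround et 1 h) = cutSet Finset.univ m h := by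
  ext (_ | _ | _) <;> simp [cutSet, natGround, ebot, etop, es, et]

theorem isDownSet_iff {m h : ℕ} (hm : 1 ≤ m) (hh : 1 ≤ h)
    (S : Finset (Bool ⊕ (ℕ ⊕ ℕ))) :
    (S ⊆ cutSet Finset.univ m h ∧
      ∀ x ∈ cutSet Finset.univ m h, ∀ y ∈ S,
        (covRel ebot (es 1) ⊔ covRel ebot (et 1) ⊔
          chainRel es 1 m ⊔ chainRel et 1 h ⊔
          covRel (es 1) (et h) ⊔ covRel (et 1) (es m) ⊔
          covRel (es m) etop ⊔ covRel (et h) etop) x y → x ∈ S) ↔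
    S = cutSet ∅ 0 0 ∨ S = cutSet Finset.univ m h ∨
      ∃ p ∈ (Finset.range (m + 1) ×ˢ Finset.range (h + 1)) \ {(m, 0), (0, h)},
        cutSet {false} p.1 p.2 = S := by
  constructor
  · rintro ⟨hS, hd⟩
    simp only [Pi.sup_apply, sup_Prop_eq, covRel, chainRel, ebot, etop, es, et] at hd
    have bot_s : Sum.inr (Sum.inl 1) ∈ S → Sum.inl false ∈ S := fun hy =>
      hd _ (inl_mem_cutSet.2 (Finset.mem_univ _)) _ hy (by simp)
    have bot_t : Sum.inr (Sum.inr 1) ∈ S → Sum.inl false ∈ S := fun hy =>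
      hd _ (inl_mem_cutSet.2 (Finset.mem_univ _)) _ hy (by simp)
    have s_t : Sum.inr (Sum.inr h) ∈ S → Sum.inr (Sum.inl 1) ∈ S := fun hy =>
      hd _ (es_mem_cutSet.2 ⟨le_rfl, hm⟩) _ hy (by simp)
    have t_s : Sum.inr (Sum.inl m) ∈ S → Sum.inr (Sum.inr 1) ∈ S := fun hy =>
      hd _ (et_mem_cutSet.2 ⟨le_rfl, hh⟩) _ hy (by simp)
    have s_top : Sum.inl true ∈ S → Sum.inr (Sum.inl m) ∈ S := fun hy =>
      hd _ (es_mem_cutSet.2 ⟨hm, le_rfl⟩) _ hy (by simp)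
    have t_top : Sum.inl true ∈ S → Sum.inr (Sum.inr h) ∈ S := fun hy =>
      hd _ (et_mem_cutSet.2 ⟨hh, le_rfl⟩) _ hy (by simp)
    obtain ⟨k, hk, hSk⟩ := exists_initial_segment (fun i => Sum.inr (Sum.inl i) ∈ S) m
      fun i h1 h2 hy => hd _ (es_mem_cutSet.2 ⟨h1, by omega⟩) _ hy (by simp [h1, Nat.lt_of_succ_le h2])
    obtain ⟨l, hl, hSl⟩ := exists_initial_segment (fun j => Sum.inr (Sum.inr j) ∈ S) h
      fun j h1 h2 hy => hd _ (et_mem_cutSet.2 ⟨h1, by omega⟩) _ hy (by simp [h1, Nat.lt_of_succ_le h2])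
    have hS_eq : ∀ B : Finset Bool, (∀ x, Sum.inl x ∈ S ↔ x ∈ B) → S = cutSet B k l := by
      intro B hB
      ext (x | i | j)
      · rw [inl_mem_cutSet, hB]
      · rw [es_mem_cutSet]
        refine ⟨fun hi => ?_, fun hi => (hSk i hi.1 (hi.2.trans hk)).2 hi.2⟩
        have hi' := es_mem_cutSet.1 (hS hi)
        exact ⟨hi'.1, (hSk i hi'.1 hi'.2).1 hi⟩
      · rw [et_mem_cutSet]
        refine ⟨fun hj => ?_, fun hj => (hSl j hj.1 (hj.2.trans hl)).2 hj.2⟩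
        have hj' := et_mem_cutSet.1 (hS hj)
        exact ⟨hj'.1, (hSl j hj'.1 hj'.2).1 hj⟩
    have s1 := hSk 1 le_rfl hm
    have sm := hSk m hm le_rfl
    have t1 := hSl 1 le_rfl hh
    have th := hSl h hh le_rfl
    rw [s1] at bot_s s_t
    rw [t1] at bot_t t_s
    rw [sm] at t_s s_top
    rw [th] at s_t t_top
    by_cases htop : Sum.inl true ∈ S
    · have hkm : k = m := le_antisymm hk (s_top htop)
      have hlh : l = h := le_antisymm hl (t_top htop)
      subst hkm hlh
      exact Or.inr (Or.inl (hS_eq _ (by simp [htop, bot_s hm])))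
    · by_cases hbot : Sum.inl false ∈ S
      · refine Or.inr (Or.inr ⟨(k, l), ?_, (hS_eq _ (by simp [htop, hbot])).symm⟩)
        simp only [Finset.mem_sdiff, Finset.mem_product, Finset.mem_range, Finset.mem_insert,
          Finset.mem_singleton, Prod.mk.injEq]
        omega
      · have hk0 : k = 0 := by
          by_contra hne
          exact hbot (bot_s (by omega))
        have hl0 : l = 0 := by
          by_contra hne
          exact hbot (bot_t (by omega))
        subst hk0 hl0
        exact Or.inl (hS_eq _ (by simp [htop, hbot]))
  · have key : ∀ (B : Finset Bool) (k l : ℕ), k ≤ m → l ≤ h →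
        (1 ≤ k ∨ 1 ≤ l → false ∈ B) → (l = h → 1 ≤ k) → (k = m → 1 ≤ l) →
        (true ∈ B → k = m ∧ l = h) →
        cutSet B k l ⊆ cutSet Finset.univ m h ∧
        ∀ x ∈ cutSet Finset.univ m h, ∀ y ∈ cutSet B k l,
        (covRel ebot (es 1) ⊔ covRel ebot (et 1) ⊔
          chainRel es 1 m ⊔ chainRel et 1 h ⊔
          covRel (es 1) (et h) ⊔ covRel (et 1) (es m) ⊔
          covRel (es m) etop ⊔ covRel (et h) etop) x y → x ∈ cutSet B k l := by
      intro B k l hk hl hbot hs ht htop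
      constructor
      · rintro (x | i | j) hx
        · simp [inl_mem_cutSet]
        · rw [es_mem_cutSet] at hx ⊢
          omega
        · rw [et_mem_cutSet] at hx ⊢
          omega
      · simp only [Pi.sup_apply, sup_Prop_eq, covRel, chainRel, ebot, etop, es, et]
        rintro x - y hy (((((((⟨rfl, rfl⟩ | ⟨rfl, rfl⟩) | ⟨i, h1, h2, rfl, rfl⟩) |
          ⟨i, h1, h2, rfl, rfl⟩) | ⟨rfl, rfl⟩) | ⟨rfl, rfl⟩) | ⟨rfl, rfl⟩) | ⟨rfl, rfl⟩)
        all_goals simp only [inl_mem_cutSet, es_mem_cutSet, et_mem_cutSet] at hy ⊢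
        · exact hbot (Or.inl hy.2)
        · exact hbot (Or.inr hy.2)
        · omega
        · omega
        · omega
        · omega
        · have := htop hy
          omega
        · have := htop hy
          omega
    rintro (rfl | rfl | ⟨⟨k, l⟩, hp, rfl⟩)
    · exact key _ _ _ (by omega) (by omega) (by omega) (by omega) (by omega) (by simp)
    · exact key _ _ _ le_rfl le_rfl (by simp) (by omega) (by omega) (by simp)
    · simp only [Finset.mem_sdiff, Finset.mem_product, Finset.mem_range, Finset.mem_insert,
        Finset.mem_singleton, Prod.mk.injEq] at hp
      exact key _ _ _ (by omega) (by omega) (by simp) (by omega) (by omega) (by simp)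

theorem doubly_notched_arc_in_triangulation_ideal_sum
    (K : Type*) [CommSemiring K]
    (m h : ℕ) (hm : 1 ≤ m) (hh : 1 ≤ h)
    (a b : ℕ → K) (c : K) :
    idealSum
        ({ebot, etop} ∪ natGround es 1 m ∪ natGround et 1 h)
        (covRel ebot (es 1) ⊔ covRel ebot (et 1) ⊔
          chainRel es 1 m ⊔ chainRel et 1 h ⊔
          covRel (es 1) (et h) ⊔ covRel (et 1) (es m) ⊔
          covRel (es m) etop ⊔ covRel (et h) etop)
        (Sum.elim (fun _ => c) (Sum.elim a b))
      + c * (∏ i ∈ Finset.Icc 1 m, a i)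
      + c * (∏ j ∈ Finset.Icc 1 h, b j)
    = 1
      + c * ((∑ k ∈ Finset.range (m + 1), ∏ i ∈ Finset.Icc 1 k, a i) *
             (∑ l ∈ Finset.range (h + 1), ∏ j ∈ Finset.Icc 1 l, b j))
      + c ^ 2 * ((∏ i ∈ Finset.Icc 1 m, a i) * (∏ j ∈ Finset.Icc 1 h, b j)) := by
  set I := (Finset.range (m + 1) ×ˢ Finset.range (h + 1)) \ {(m, 0), (0, h)} with hI
  set f : ℕ × ℕ → K := fun p => (∏ i ∈ Finset.Icc 1 p.1, a i) * ∏ j ∈ Finset.Icc 1 p.2, b j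
    with hf
  have hsum : (∑ p ∈ I, f p) + ((∏ i ∈ Finset.Icc 1 m, a i) + ∏ j ∈ Finset.Icc 1 h, b j) =
      (∑ k ∈ Finset.range (m + 1), ∏ i ∈ Finset.Icc 1 k, a i) *
        ∑ l ∈ Finset.range (h + 1), ∏ j ∈ Finset.Icc 1 l, b j := by
    have hsub : ({(m, 0), (0, h)} : Finset (ℕ × ℕ)) ⊆
        Finset.range (m + 1) ×ˢ Finset.range (h + 1) := by
      simp [Finset.insert_subset_iff]
    have hne : (m, 0) ≠ (0, h) := by
      simp only [ne_eq, Prod.mk.injEq]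
      omega
    rw [Finset.sum_mul_sum, ← Finset.sum_product', ← Finset.sum_sdiff hsub,
      Finset.sum_pair hne]
    simp [hf, hI]
  have hZ : ∑ S ∈ insert (cutSet ∅ 0 0) (insert (cutSet Finset.univ m h)
        (I.image fun p => cutSet {false} p.1 p.2)),
        ∏ x ∈ S, Sum.elim (fun _ => c) (Sum.elim a b) x =
      1 + (c ^ 2 * f (m, h) + c * ∑ p ∈ I, f p) := by
    rw [Finset.sum_insert, Finset.sum_insert, Finset.sum_image, Finset.mul_sum]
    · simp [prod_cutSet, hf]
    · rintro ⟨k, l⟩ - ⟨k', l'⟩ - heq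
      simpa [cutSet_inj] using heq
    · rw [Finset.mem_image]
      rintro ⟨p, -, heq⟩
      simpa using (Finset.ext_iff.1 (cutSet_inj.1 heq).1) true
    · rw [Finset.mem_insert, Finset.mem_image]
      rintro (heq | ⟨p, -, heq⟩)
      · simpa using (Finset.ext_iff.1 (cutSet_inj.1 heq).1) true
      · simpa using (Finset.ext_iff.1 (cutSet_inj.1 heq).1) false
  rw [ground_eq_cutSet, idealSum_eq_sum _ _ fun S => (isDownSet_iff hm hh S).trans (by
    rw [Finset.mem_insert, Finset.mem_insert, Finset.mem_image]), hZ, ← hsum]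
  simp only [hf]
  ring
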